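/- Let M be a real c×d matrix, let m ≤ min(c,d), and let σ₁ ≥ σ₂ ≥ … ≥ σ_m be the m largest singular values of M (the nonnegative square roots of the m largest eigenvalues of MᵀM). Then for all real matrices A ∈ ℝ^{c×m} and W ∈ ℝ^{d×m} satisfying the joint orthonormality constraint AᵀA + WᵀW = I_m (the m×m identity), the total utility satisfies tr(Aᵀ M W) ≤ (1/2)·Σ_{i=1}^m σ_i. Moreover, this bound is attained: there exist A, W satisfying the constraint with tr(Aᵀ M W) = (1/2)·Σ_{i=1}^m σ_i, namely A and W whose i-th columns are (1/√2)·u_i and (1/√2)·v_i respectively, where (u_i, v_i) are left and right singular vector pairs of M for σ_i. -/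

import Mathlib

open scoped Matrix

/-- Singular value decomposition in the form we need. -/
lemma svd_aux {c d : ℕ} (M : Matrix (Fin c) (Fin d) ℝ) (hH : (Mᵀ * M).IsHermitian)
    (g : Equiv.Perm (Fin d)) (s : Fin d → ℝ)
    (hs : ∀ j, s j = Real.sqrt (hH.eigenvalues (g j))) :
    ∃ (U : Matrix (Fin c) (Fin d) ℝ) (V : Matrix (Fin d) (Fin d) ℝ),
      Vᵀ * V = 1 ∧ M * V = U * Matrix.diagonal s ∧ Mᵀ * U = V * Matrix.diagonal s ∧
      Uᵀ * U = Matrix.diagonal (fun j => if s j = 0 then (0 : ℝ) else 1) := by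
  have hpsd : (Mᵀ * M).PosSemidef := by
    simpa using Matrix.posSemidef_conjTranspose_mul_self M
  have hs2 : ∀ j, s j * s j = hH.eigenvalues (g j) := fun j => by
    rw [hs, Real.mul_self_sqrt (hpsd.eigenvalues_nonneg _)]
  let V : Matrix (Fin d) (Fin d) ℝ := Matrix.of fun i j => hH.eigenvectorBasis (g j) i
  have hV : Vᵀ * V = 1 := by
    ext i j
    have h := orthonormal_iff_ite.1 hH.eigenvectorBasis.orthonormal (g j) (g i)
    simp only [PiLp.inner_apply, RCLike.inner_apply, conj_trivial, g.injective.eq_iff] at h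
    rw [Matrix.mul_apply, Matrix.one_apply]
    simp only [V, Matrix.transpose_apply, Matrix.of_apply]
    rw [h]
    simp [eq_comm]
  have hE : Mᵀ * (M * V) = V * Matrix.diagonal (fun j => s j * s j) := by
    ext i j
    have h := congrFun (hH.mulVec_eigenvectorBasis (g j)) i
    rw [← Matrix.mul_assoc, Matrix.mul_diagonal, hs2, Matrix.mul_apply]
    simp only [Matrix.mulVec, dotProduct, Pi.smul_apply, smul_eq_mul] at h
    simp only [V, Matrix.of_apply]
    rw [h, mul_comm]
  have hN : (M * V)ᵀ * (M * V) = Matrix.diagonal (fun j => s j * s j) := by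
    rw [Matrix.transpose_mul, Matrix.mul_assoc, hE, ← Matrix.mul_assoc, hV, Matrix.one_mul]
  have hz : ∀ j, s j = 0 → ∀ i, (M * V) i j = 0 := by
    intro j hj i
    have h := congrFun (congrFun hN j) j
    rw [Matrix.mul_apply, Matrix.diagonal_apply_eq, hj, mul_zero] at h
    simp only [Matrix.transpose_apply] at h
    have := (Finset.sum_eq_zero_iff_of_nonneg (fun i _ => mul_self_nonneg ((M * V) i j))).1 h i
      (Finset.mem_univ _)
    exact mul_self_eq_zero.1 this
  refine ⟨M * V * Matrix.diagonal (fun j => (s j)⁻¹), V, hV, ?_, ?_, ?_⟩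
  · ext i j
    rw [Matrix.mul_diagonal, Matrix.mul_diagonal]
    by_cases hj : s j = 0
    · rw [hz j hj i]; simp
    · field_simp
  · rw [← Matrix.mul_assoc, hE, Matrix.mul_assoc, Matrix.diagonal_mul_diagonal]
    congr 2
    ext j
    by_cases hj : s j = 0
    · simp [hj]
    · field_simp
  · rw [Matrix.transpose_mul, Matrix.diagonal_transpose, Matrix.mul_assoc,
      ← Matrix.mul_assoc (M * V)ᵀ, hN, Matrix.diagonal_mul_diagonal, Matrix.diagonal_mul_diagonal]
    congr 1
    ext j
    by_cases hj : s j = 0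
    · simp [hj]
    · simp only [hj, if_false]; field_simp

/-- Bessel inequality for orthogonal columns of norm at most one. -/
lemma bessel_aux {n k : Type*} [Fintype n] [Fintype k] [DecidableEq k]
    (Y : Matrix n k ℝ) (t : k → ℝ) (hY : Yᵀ * Y = Matrix.diagonal t) (ht : ∀ i, t i ≤ 1)
    (z : n → ℝ) : ∑ i, (∑ l, Y l i * z l) ^ 2 ≤ ∑ l, z l ^ 2 := by
  have e : ∑ i, (∑ l, Y l i * z l) ^ 2 = (Yᵀ *ᵥ z) ⬝ᵥ (Yᵀ *ᵥ z) := by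
    simp [dotProduct, Matrix.mulVec, sq]
  have e2 : ∑ l, z l ^ 2 = z ⬝ᵥ z := by simp [dotProduct, sq]
  rw [e, e2]
  set b := Yᵀ *ᵥ z with hb
  have h0 : 0 ≤ (z - Y *ᵥ b) ⬝ᵥ (z - Y *ᵥ b) :=
    Finset.sum_nonneg fun i _ => mul_self_nonneg _
  have h1 : z ⬝ᵥ (Y *ᵥ b) = b ⬝ᵥ b := by
    rw [Matrix.dotProduct_mulVec, ← Matrix.mulVec_transpose]
  have h2 : (Y *ᵥ b) ⬝ᵥ (Y *ᵥ b) = ∑ i, t i * b i ^ 2 := by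
    rw [Matrix.dotProduct_mulVec, ← Matrix.mulVec_transpose, Matrix.mulVec_mulVec, hY]
    simp only [dotProduct, Matrix.mulVec_diagonal]
    exact Finset.sum_congr rfl fun i _ => by ring
  have h3 : ∑ i, t i * b i ^ 2 ≤ b ⬝ᵥ b := by
    simp only [dotProduct]
    exact Finset.sum_le_sum fun i _ => by nlinarith [ht i, sq_nonneg (b i)]
  rw [sub_dotProduct, dotProduct_sub, dotProduct_sub, h2, dotProduct_comm (Y *ᵥ b) z, h1] at h0
  linarith

lemma weighted_aux {m e : ℕ} (s q : Fin (m + e) → ℝ) (hs : Antitone s) (hs0 : ∀ j, 0 ≤ s j)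
    (hq0 : ∀ j, 0 ≤ q j) (hq1 : ∀ j, q j ≤ 1) (hq : ∑ j, q j ≤ m) :
    ∑ j, s j * q j ≤ ∑ i : Fin m, s (Fin.castAdd e i) := by
  obtain ⟨t, ht0, ht1, ht2⟩ : ∃ t : ℝ, 0 ≤ t ∧ (∀ i : Fin m, t ≤ s (Fin.castAdd e i)) ∧
      ∀ i : Fin e, m ≠ 0 → s (Fin.natAdd m i) ≤ t := by
    rcases Nat.eq_zero_or_pos m with h | h
    · subst h
      exact ⟨0, le_rfl, fun i => i.elim0, fun i h => absurd rfl h⟩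
    · refine ⟨s (Fin.castAdd e ⟨m - 1, by omega⟩), hs0 _, fun i => hs ?_, fun i _ => hs ?_⟩
      · rw [Fin.le_def]; simp; omega
      · rw [Fin.le_def]; simp; omega
  rcases Nat.eq_zero_or_pos m with h | h
  · subst h
    have hz : ∀ j, q j = 0 := fun j =>
      (Finset.sum_eq_zero_iff_of_nonneg (fun j _ => hq0 j)).1
        (le_antisymm (by simpa using hq) (Finset.sum_nonneg fun j _ => hq0 j)) j (Finset.mem_univ _)
    simp [hz]
  · have h1 : ∀ i : Fin m, s (Fin.castAdd e i) * q (Fin.castAdd e i) ≤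
        s (Fin.castAdd e i) - t + t * q (Fin.castAdd e i) := fun i => by
      nlinarith [ht1 i, hq1 (Fin.castAdd e i)]
    have h2 : ∀ i : Fin e, s (Fin.natAdd m i) * q (Fin.natAdd m i) ≤ t * q (Fin.natAdd m i) :=
      fun i => mul_le_mul_of_nonneg_right (ht2 i (by omega)) (hq0 _)
    have h3 := Finset.sum_le_sum fun i (_ : i ∈ Finset.univ) => h1 i
    have h4 := Finset.sum_le_sum fun i (_ : i ∈ Finset.univ) => h2 i
    rw [Fin.sum_univ_add] at hq ⊢
    simp only [Finset.sum_add_distrib, Finset.sum_sub_distrib, ← Finset.mul_sum,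
      Finset.sum_const, Finset.card_univ, Fintype.card_fin, nsmul_eq_mul] at h3 h4
    nlinarith [mul_le_mul_of_nonneg_left hq ht0]

lemma upper_aux {c m d : ℕ} (M : Matrix (Fin c) (Fin d) ℝ) (s : Fin d → ℝ)
    (U : Matrix (Fin c) (Fin d) ℝ) (V : Matrix (Fin d) (Fin d) ℝ)
    (hs0 : ∀ j, 0 ≤ s j)
    (hV : Vᵀ * V = 1) (hMV : M * V = U * Matrix.diagonal s)
    (hU : Uᵀ * U = Matrix.diagonal (fun j => if s j = 0 then (0 : ℝ) else 1))
    (A : Matrix (Fin c) (Fin m) ℝ) (W : Matrix (Fin d) (Fin m) ℝ)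
    (hAW : Aᵀ * A + Wᵀ * W = 1) :
    ∃ q : Fin d → ℝ, (∀ j, 0 ≤ q j) ∧ (∀ j, q j ≤ 1) ∧ ∑ j, q j ≤ m ∧
      (Aᵀ * M * W).trace ≤ (1 / 2) * ∑ j, s j * q j := by
  have hr : (Real.sqrt 2)⁻¹ * (Real.sqrt 2)⁻¹ = 1 / 2 := by
    rw [← mul_inv, Real.mul_self_sqrt (by norm_num)]; norm_num
  have hVV : V * Vᵀ = 1 := mul_eq_one_comm.1 hV
  let r := (Real.sqrt 2)⁻¹
  let Y : Matrix (Fin c ⊕ Fin d) (Fin m) ℝ := Matrix.fromRows A W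
  let Z : Matrix (Fin c ⊕ Fin d) (Fin d) ℝ := Matrix.fromRows (r • U) (r • V)
  have hY : Yᵀ * Y = Matrix.diagonal (fun _ => 1) := by
    simp only [Y, Matrix.transpose_fromRows, Matrix.fromCols_mul_fromRows, hAW]
    simp
  have hZ : Zᵀ * Z = Matrix.diagonal (fun j => if s j = 0 then (1 / 2 : ℝ) else 1) := by
    simp only [Z, Matrix.transpose_fromRows, Matrix.fromCols_mul_fromRows, Matrix.transpose_smul,
      Matrix.smul_mul, Matrix.mul_smul, smul_smul, hV, hU, r, hr]
    ext i j
    by_cases hij : i = j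
    · subst hij
      by_cases hi : s i = 0 <;> simp [hi] <;> norm_num
    · simp [hij]
  have hZ1 : ∀ j, (if s j = 0 then (1 / 2 : ℝ) else 1) ≤ 1 := fun j => by split_ifs <;> norm_num
  have hcol : ∀ j, ∑ l, Z l j ^ 2 ≤ 1 := fun j => by
    have h := congrFun (congrFun hZ j) j
    rw [Matrix.mul_apply, Matrix.diagonal_apply_eq] at h
    simp only [Matrix.transpose_apply, ← sq] at h
    rw [h]; exact hZ1 j
  have hYcol : ∀ k, ∑ l, Y l k ^ 2 = 1 := fun j => by
    have h := congrFun (congrFun hY j) j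
    rw [Matrix.mul_apply, Matrix.diagonal_apply_eq] at h
    simpa only [Matrix.transpose_apply, ← sq] using h
  refine ⟨fun j => ∑ k, (∑ l, Y l k * Z l j) ^ 2, fun j => Finset.sum_nonneg fun _ _ => sq_nonneg _,
    fun j => (bessel_aux Y _ hY (fun _ => le_rfl) (fun l => Z l j)).trans (hcol j), ?_, ?_⟩
  · rw [Finset.sum_comm]
    calc _ ≤ ∑ k : Fin m, (1 : ℝ) := Finset.sum_le_sum fun k _ => by
          have := bessel_aux Z _ hZ hZ1 (fun l => Y l k)
          rw [hYcol] at this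
          simpa only [mul_comm] using this
      _ = m := by simp
  · have h1 : Aᵀ * M * W = (Aᵀ * U) * Matrix.diagonal s * (Wᵀ * V)ᵀ := by
      rw [Matrix.mul_assoc Aᵀ U, ← hMV, Matrix.transpose_mul, Matrix.transpose_transpose]
      calc Aᵀ * M * W = Aᵀ * M * (V * Vᵀ) * W := by rw [hVV, Matrix.mul_one]
        _ = _ := by simp only [Matrix.mul_assoc]
    have h2 : (Aᵀ * M * W).trace
        = ∑ j, s j * ∑ k, (Aᵀ * U) k j * (Wᵀ * V) k j := by
      rw [h1]
      generalize Aᵀ * U = P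
      generalize Wᵀ * V = Q
      rw [Matrix.trace]
      simp only [Matrix.diag_apply, Matrix.mul_apply (M := P * Matrix.diagonal s),
        Matrix.mul_diagonal, Matrix.transpose_apply]
      rw [Finset.sum_comm]
      refine Finset.sum_congr rfl fun j _ => ?_
      rw [Finset.mul_sum]
      exact Finset.sum_congr rfl fun k _ => by ring
    rw [h2, Finset.mul_sum]
    refine Finset.sum_le_sum fun j _ => ?_
    rw [mul_left_comm]
    refine mul_le_mul_of_nonneg_left ?_ (hs0 j)
    rw [Finset.mul_sum]
    refine Finset.sum_le_sum fun k _ => ?_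
    have h3 : ∑ l, Y l k * Z l j = r * ((Aᵀ * U) k j + (Wᵀ * V) k j) := by
      simp only [Fintype.sum_sum_type, Y, Z, Matrix.fromRows_apply_inl, Matrix.fromRows_apply_inr,
        Matrix.smul_apply, smul_eq_mul, Matrix.mul_apply, Matrix.transpose_apply, mul_add,
        Finset.mul_sum, mul_left_comm]
    rw [h3, mul_pow, sq r, hr]
    nlinarith [sq_nonneg ((Aᵀ * U) k j - (Wᵀ * V) k j)]


/-- Rayleigh-quotient maximization over the Stiefel manifold for two-layer fully connected
linear networks: under the joint orthonormality constraint `AᵀA + WᵀW = I`, the total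
utility `tr(Aᵀ M W)` is at most half the sum of the `m` largest singular values of `M`
(the nonnegative square roots of the `m` largest eigenvalues of `MᵀM`), and the bound is
attained by matrices whose columns are `(1/√2)·uᵢ` and `(1/√2)·vᵢ` for singular vector
pairs `(uᵢ, vᵢ)` of `M`. -/
theorem stiefel_utility_maximization
    (c d m : ℕ) (hm : m ≤ min c d)
    (M : Matrix (Fin c) (Fin d) ℝ)
    (hH : (Mᵀ * M).IsHermitian)
    (σ : Fin m → ℝ)
    (hσ : ∃ g : Equiv.Perm (Fin d), Antitone (hH.eigenvalues ∘ g) ∧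
      ∀ i : Fin m, σ i
        = Real.sqrt (hH.eigenvalues (g (Fin.castLE (hm.trans (min_le_right c d)) i)))) :
    (∀ (A : Matrix (Fin c) (Fin m) ℝ) (W : Matrix (Fin d) (Fin m) ℝ),
      Aᵀ * A + Wᵀ * W = 1 → (Aᵀ * M * W).trace ≤ (1 / 2) * ∑ i, σ i) ∧
    (∃ (u : Fin m → Fin c → ℝ) (v : Fin m → Fin d → ℝ),
      (∀ i, M.mulVec (v i) = σ i • u i ∧ Mᵀ.mulVec (u i) = σ i • v i) ∧
      ∃ (A : Matrix (Fin c) (Fin m) ℝ) (W : Matrix (Fin d) (Fin m) ℝ),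
        (∀ (j : Fin c) (i : Fin m), A j i = (Real.sqrt 2)⁻¹ * u i j) ∧
        (∀ (j : Fin d) (i : Fin m), W j i = (Real.sqrt 2)⁻¹ * v i j) ∧
        Aᵀ * A + Wᵀ * W = 1 ∧
        (Aᵀ * M * W).trace = (1 / 2) * ∑ i, σ i) := by
  obtain ⟨g, hg, hσ⟩ := hσ
  have hmd : m ≤ d := hm.trans (min_le_right c d)
  let s : Fin d → ℝ := fun j => Real.sqrt (hH.eigenvalues (g j))
  have hs : ∀ j, s j = Real.sqrt (hH.eigenvalues (g j)) := fun _ => rfl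
  have hanti : Antitone s := fun i j hij => Real.sqrt_le_sqrt (hg hij)
  have hs0 : ∀ j, 0 ≤ s j := fun j => Real.sqrt_nonneg _
  obtain ⟨U, V, hV, hMV, hMU, hU⟩ := svd_aux M hH g s hs
  have hσs : ∀ i, σ i = s (Fin.castLE hmd i) := hσ
  clear_value s
  clear hσ hs hg
  constructor
  · intro A W hAW
    obtain ⟨q, hq0, hq1, hq, hle⟩ := upper_aux M s U V hs0 hV hMV hU A W hAW
    refine hle.trans (mul_le_mul_of_nonneg_left ?_ (by norm_num))
    simp only [hσs]
    clear hσs hle hU hMV hMU hV hAW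
    clear U V A W hH
    clear M g
    obtain ⟨e, rfl⟩ := Nat.exists_eq_add_of_le hmd
    exact weighted_aux s q hanti hs0 hq0 hq1 hq
  · have hr : (Real.sqrt 2)⁻¹ * (Real.sqrt 2)⁻¹ = 1 / 2 := by
      rw [← mul_inv, Real.mul_self_sqrt (by norm_num)]; norm_num
    have h2 : Real.sqrt 2 * Real.sqrt 2 = 2 := Real.mul_self_sqrt (by norm_num)
    let f : Fin m → Fin d := Fin.castLE hmd
    have hf : Function.Injective f := Fin.castLE_injective hmd
    let w : Fin m → ℝ := fun i => if s (f i) = 0 then Real.sqrt 2 else 1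
    have hM1 : ∀ j i, ∑ k, M i k * V k j = U i j * s j := fun j i => by
      have := congrFun (congrFun hMV i) j
      rwa [Matrix.mul_diagonal, Matrix.mul_apply] at this
    have hM2 : ∀ j i, ∑ k, M k i * U k j = V i j * s j := fun j i => by
      have := congrFun (congrFun hMU i) j
      rwa [Matrix.mul_diagonal, Matrix.mul_apply] at this
    have hsw : ∀ i, s (f i) * w i = s (f i) := fun i => by
      by_cases h : s (f i) = 0 <;> simp [w, h]
    have hU' : ∀ i j, ∑ k, U k i * U k j = if i = j then (if s i = 0 then 0 else 1) else 0 :=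
      fun i j => by
        have := congrFun (congrFun hU i) j
        rwa [Matrix.mul_apply, Matrix.diagonal_apply] at this
    have hV' : ∀ i j, ∑ k, V k i * V k j = if i = j then 1 else 0 :=
      fun i j => by
        have := congrFun (congrFun hV i) j
        rwa [Matrix.mul_apply, Matrix.one_apply] at this
    have hsing : ∀ i, M.mulVec (fun j => w i * V j (f i)) = σ i • (fun j => U j (f i)) := by
      intro i
      ext l
      simp only [Matrix.mulVec, dotProduct, Pi.smul_apply, smul_eq_mul, hσs]
      calc ∑ k, M l k * (w i * V k (f i)) = w i * ∑ k, M l k * V k (f i) := by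
            rw [Finset.mul_sum]; exact Finset.sum_congr rfl fun k _ => by ring
        _ = (s (f i) * w i) * U l (f i) := by rw [hM1]; ring
        _ = _ := by rw [hsw]
    refine ⟨fun i j => U j (f i), fun i j => w i * V j (f i), fun i => ⟨hsing i, ?_⟩,
      Matrix.of fun j i => (Real.sqrt 2)⁻¹ * U j (f i),
      Matrix.of fun j i => (Real.sqrt 2)⁻¹ * (w i * V j (f i)),
      fun _ _ => rfl, fun _ _ => rfl, ?_, ?_⟩
    · ext l
      simp only [Matrix.mulVec, dotProduct, Pi.smul_apply, smul_eq_mul, hσs,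
        Matrix.transpose_apply]
      rw [hM2, ← mul_assoc]
      change _ = s (f i) * w i * _
      rw [hsw, mul_comm]
    · ext i j
      simp only [Matrix.add_apply, Matrix.mul_apply, Matrix.transpose_apply, Matrix.of_apply]
      have e1 : ∑ k, (Real.sqrt 2)⁻¹ * U k (f i) * ((Real.sqrt 2)⁻¹ * U k (f j))
          = 1 / 2 * ∑ k, U k (f i) * U k (f j) := by
        rw [Finset.mul_sum, ← hr]; exact Finset.sum_congr rfl fun k _ => by ring
      have e2 : ∑ k, (Real.sqrt 2)⁻¹ * (w i * V k (f i)) * ((Real.sqrt 2)⁻¹ * (w j * V k (f j)))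
          = 1 / 2 * (w i * w j) * ∑ k, V k (f i) * V k (f j) := by
        rw [Finset.mul_sum, ← hr]; exact Finset.sum_congr rfl fun k _ => by ring
      rw [e1, e2, hU', hV', Matrix.one_apply]
      by_cases hij : i = j
      · subst hij
        by_cases h : s (f i) = 0
        · simp [w, h, h2]
        · simp [w, h]; norm_num
      · simp [hij, hf.eq_iff]
    · rw [Matrix.trace, Finset.mul_sum]
      refine Finset.sum_congr rfl fun i _ => ?_
      rw [Matrix.diag_apply, Matrix.mul_assoc, Matrix.mul_apply]
      simp only [Matrix.mul_apply, Matrix.transpose_apply, Matrix.of_apply]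
      have e3 : ∀ l, ∑ k, M l k * ((Real.sqrt 2)⁻¹ * (w i * V k (f i)))
          = (Real.sqrt 2)⁻¹ * (s (f i) * U l (f i)) := fun l => by
        have := congrFun (hsing i) l
        simp only [Matrix.mulVec, dotProduct, Pi.smul_apply, smul_eq_mul, hσs] at this
        change _ = s (f i) * _ at this
        rw [← this, Finset.mul_sum]
        exact Finset.sum_congr rfl fun k _ => by ring
      simp only [e3]
      calc _ = 1 / 2 * s (f i) * ∑ l, U l (f i) * U l (f i) := by
            rw [Finset.mul_sum, ← hr]; exact Finset.sum_congr rfl fun k _ => by ring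
        _ = 1 / 2 * σ i := by
            rw [hU', hσs]
            change _ = 1 / 2 * s (f i)
            by_cases h : s (f i) = 0 <;> simp [h]
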